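/- Let T = (Q, Σ, δ) be an S-automaton and let L ⊆ Q* be a finitely suffix-closed language of state sequences. Then the subset L∘ = {𝐪∘ ∣ 𝐪 ∈ L} of S(T) is infinite if and only if there is an ω-word ξ ∈ Σ^ω with infinite L-orbit L∘ξ. -/

import Mathlib

/- Common framework for automaton semigroups acting on finite and infinite words.

An S-automaton over states `Q` and alphabet `A` is given by a partial deterministic
transition function `δ : Q → A → Option (A × Q)` (with `δ q a = some (b, p)` encoding
the transition `q –a/b→ p`). -/

namespace AutOrbit

variable {Q A : Type*}

/-- The partial action `q∘` of a single state on a finite word. -/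
def stateAct (δ : Q → A → Option (A × Q)) : Q → List A → Option (List A)
  | _, [] => some []
  | q, a :: u => (δ q a).bind fun bp => (stateAct δ bp.2 u).map fun v => bp.1 :: v

/-- The partial action `𝐪∘` of a state sequence `𝐪 = q_n … q_1` (written left-to-right,
head of the list is `q_n`; the rightmost state `q_1` is applied first). -/
def seqAct (δ : Q → A → Option (A × Q)) (l : List Q) (u : List A) : Option (List A) :=
  l.foldr (fun q acc => acc.bind (stateAct δ q)) (some u)

/-- The length-`n` prefix of an ω-word. -/
def pre (ξ : ℕ → A) (n : ℕ) : List A := List.ofFn fun i : Fin n => ξ i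

/-- The `L`-orbit `L∘u` of a finite word `u`. -/
def orbit (δ : Q → A → Option (A × Q)) (L : Set (List Q)) (u : List A) : Set (List A) :=
  {v | ∃ l ∈ L, seqAct δ l u = some v}

/-- The `L`-orbit `L∘ξ` of an ω-word `ξ`: all ω-words `η` such that some `𝐪 ∈ L` is
defined on `ξ` with `𝐪∘ξ = η` (i.e. `𝐪∘` maps every prefix of `ξ` to the
corresponding prefix of `η`). -/
def omegaOrbit (δ : Q → A → Option (A × Q)) (L : Set (List Q)) (ξ : ℕ → A) :
    Set (ℕ → A) :=
  {η | ∃ l ∈ L, ∀ n, seqAct δ l (pre ξ n) = some (pre η n)}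

/-- The set of partial maps `L∘ = {𝐪∘ ∣ 𝐪 ∈ L}`. -/
def mapsOf (δ : Q → A → Option (A × Q)) (L : Set (List Q)) :
    Set (List A → Option (List A)) :=
  {f | ∃ l ∈ L, f = seqAct δ l}

/-- `L ⊆ F*` is suffix-closed over `F`: every `𝐪 ∈ L` factorizes into factors from `F`
such that every suffix (as a word over the alphabet `F`) of the factorization is
again in `L`. -/
def SuffixClosedOver (F L : Set (List Q)) : Prop :=
  ∀ l ∈ L, ∃ fs : List (List Q),
    (∀ f ∈ fs, f ∈ F) ∧ fs.flatten = l ∧ ∀ i, (fs.drop i).flatten ∈ L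

/-- `L` is finitely suffix-closed: suffix-closed over some finite nonempty `F ⊆ Q*`. -/
def FinitelySuffixClosed (L : Set (List Q)) : Prop :=
  ∃ F : Set (List Q), F.Finite ∧ F.Nonempty ∧ SuffixClosedOver F L

/-- `u` has infinite potential w.r.t. `δ` and `L`: the orbit sizes `|L∘ux|` are unbounded. -/
def InfinitePotential (δ : Q → A → Option (A × Q)) (L : Set (List Q)) (u : List A) : Prop :=
  ∀ C : ℕ, ∃ x : List A, C < (orbit δ L (u ++ x)).ncard

/-- The `i`-th power `𝐪^i` of a state sequence. -/
def listPow (l : List Q) (i : ℕ) : List Q := (List.replicate i l).flatten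

/-- `𝐪∘` has torsion: two distinct positive powers induce the same partial map. -/
def HasTorsion (δ : Q → A → Option (A × Q)) (l : List Q) : Prop :=
  ∃ i j : ℕ, 1 ≤ i ∧ 1 ≤ j ∧ i ≠ j ∧ seqAct δ (listPow l i) = seqAct δ (listPow l j)

/-- The automaton is complete: `δ` is total. -/
def Complete (δ : Q → A → Option (A × Q)) : Prop := ∀ q a, (δ q a).isSome

/-- The automaton is invertible: for every state, the letter-to-output-letter map is a
bijection of the alphabet (each output letter is produced by exactly one input letter). -/
def Invertible (δ : Q → A → Option (A × Q)) : Prop :=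
  ∀ q b, ∃! a, ∃ p, δ q a = some (b, p)

/-- A G-automaton: a complete invertible S-automaton. -/
def GAutomaton (δ : Q → A → Option (A × Q)) : Prop := Complete δ ∧ Invertible δ

/-- Reversibility: for every input letter `a` and target state `p` there is at most one
transition `q –a/b→ p`. -/
def Reversible (δ : Q → A → Option (A × Q)) : Prop :=
  ∀ a p q₁ b₁ q₂ b₂, δ q₁ a = some (b₁, p) → δ q₂ a = some (b₂, p) → q₁ = q₂

/-- Reversibility of the inverse automaton: for every output letter `b` and target
state `p` there is at most one transition `q –a/b→ p`. -/
def InvReversible (δ : Q → A → Option (A × Q)) : Prop :=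
  ∀ b p q₁ a₁ q₂ a₂, δ q₁ a₁ = some (b, p) → δ q₂ a₂ = some (b, p) → q₁ = q₂ ∧ a₁ = a₂

/-- Bi-reversibility: the automaton and its inverse automaton are both reversible. -/
def BiReversible (δ : Q → A → Option (A × Q)) : Prop := Reversible δ ∧ InvReversible δ

/-- The dual automaton `∂T`: states are letters, letters are states; it has a transition
`a –q/p→ b` for every transition `q –a/b→ p` of `T`. -/
def dual (δ : Q → A → Option (A × Q)) : A → Q → Option (Q × A) :=
  fun a q => (δ q a).map fun bp => (bp.2, bp.1)

/-- Adjacency of states in the underlying undirected graph of the automaton. -/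
def Adj (δ : Q → A → Option (A × Q)) (q p : Q) : Prop :=
  (∃ a b, δ q a = some (b, p)) ∨ (∃ a b, δ p a = some (b, q))

/-- `P` is (the state set of) a connected component of the automaton. -/
def IsComponent (δ : Q → A → Option (A × Q)) (P : Set Q) : Prop :=
  ∃ q, P = {p | Relation.ReflTransGen (Adj δ) q p}

/-- The sub-automaton induced on `P` (with all transitions among states of `P`)
is reversible. -/
def SubReversible (δ : Q → A → Option (A × Q)) (P : Set Q) : Prop :=
  ∀ a : A, ∀ p ∈ P, ∀ q₁ b₁ q₂ b₂, q₁ ∈ P → q₂ ∈ P →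
    δ q₁ a = some (b₁, p) → δ q₂ a = some (b₂, p) → q₁ = q₂

/-- The inverse of the sub-automaton induced on `P` is reversible. -/
def SubInvReversible (δ : Q → A → Option (A × Q)) (P : Set Q) : Prop :=
  ∀ b : A, ∀ p ∈ P, ∀ q₁ a₁ q₂ a₂, q₁ ∈ P → q₂ ∈ P →
    δ q₁ a₁ = some (b, p) → δ q₂ a₂ = some (b, p) → q₁ = q₂ ∧ a₁ = a₂

/-- The sub-automaton induced on `P` is bi-reversible. -/
def SubBiReversible (δ : Q → A → Option (A × Q)) (P : Set Q) : Prop :=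
  SubReversible δ P ∧ SubInvReversible δ P

/-- For a complete automaton, the (total) action of a state on a finite word. -/
noncomputable def totAct (δ : Q → A → Option (A × Q)) (q : Q) (u : List A) : List A :=
  (stateAct δ q u).getD u

/-- The action of a state of the automaton (`Sum.inl`) or of its inverse automaton
(`Sum.inr`): for a G-automaton, `totAct δ q` is a bijection of `Σ*` and the inverse
state `q̄` acts as its inverse bijection. -/
noncomputable def gAct (δ : Q → A → Option (A × Q)) : Q ⊕ Q → List A → List A
  | Sum.inl q => totAct δ q
  | Sum.inr q => Function.invFun (totAct δ q)

/-- Action of a sequence over `Q ⊔ Q̄` (rightmost entry applied first). -/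
noncomputable def gSeqAct (δ : Q → A → Option (A × Q)) (l : List (Q ⊕ Q)) (u : List A) :
    List A :=
  l.foldr (fun s v => gAct δ s v) u

/-- The automaton group `G(T) = {𝐪∘ ∣ 𝐪 ∈ (Q ⊔ Q̄)⁺}` as a set of maps on `Σ*`. -/
def autGroup (δ : Q → A → Option (A × Q)) : Set (List A → List A) :=
  {f | ∃ l : List (Q ⊕ Q), l ≠ [] ∧ f = gSeqAct δ l}

/-- The ultimately periodic ω-word `u (a v)^ω`. -/
def ultPer (u : List A) (a : A) (v : List A) (n : ℕ) : A :=
  if h : n < u.length then u.get ⟨n, h⟩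
  else (a :: v).get ⟨(n - u.length) % (a :: v).length, Nat.mod_lt _ (by simp)⟩

/-- Run of a single state on a word, returning the output word and the final state. -/
def runState (δ : Q → A → Option (A × Q)) : Q → List A → Option (List A × Q)
  | q, [] => some ([], q)
  | q, a :: u => (δ q a).bind fun bp =>
      (runState δ bp.2 u).map fun vr => (bp.1 :: vr.1, vr.2)

/-- Run of a state sequence `𝐪` on a word `u`, returning the output word `𝐪∘u` and the
residual state sequence `𝐪·u` (the dual action). -/
def runSeq (δ : Q → A → Option (A × Q)) : List Q → List A → Option (List A × List Q)
  | [], u => some (u, [])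
  | q :: l, u => (runSeq δ l u).bind fun vr =>
      (runState δ q vr.1).map fun wp => (wp.1, wp.2 :: vr.2)

/-- Nodes of the `L`-orbital transducer over `F` of `u`: words reached from `u` along a
path of `F`-labeled edges whose reverse label (a word over `F`) lies in `L`. -/
def transNodes (δ : Q → A → Option (A × Q)) (F L : Set (List Q)) (u : List A) :
    Set (List A) :=
  {v | ∃ fs : List (List Q), (∀ f ∈ fs, f ∈ F) ∧ fs.flatten ∈ L ∧
        ∃ r, runSeq δ fs.flatten u = some (v, r)}

/-- Edges of the `L`-orbital transducer over `F` of `u`: an edge `v –𝐩/𝐨→ w` with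
`𝐩 ∈ F`, input label `𝐩`, output label `𝐨 = 𝐩·v`, lying on a path from `u` whose
reverse label is in `L`. -/
def transEdge (δ : Q → A → Option (A × Q)) (F L : Set (List Q)) (u : List A)
    (v : List A) (p o : List Q) (w : List A) : Prop :=
  p ∈ F ∧ ∃ fs : List (List Q), (∀ f ∈ fs, f ∈ F) ∧ (p :: fs).flatten ∈ L ∧
    (∃ r, runSeq δ fs.flatten u = some (v, r)) ∧ runSeq δ p v = some (w, o)

/-- Isomorphism of the `L`-orbital transducers over `F` of `u₁` and `u₂`: a bijection of
the node sets mapping `u₁` to `u₂` and preserving labeled edges in both directions. -/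
def TransducerIso (δ : Q → A → Option (A × Q)) (F L : Set (List Q)) (u₁ u₂ : List A) :
    Prop :=
  ∃ φ : List A → List A,
    Set.BijOn φ (transNodes δ F L u₁) (transNodes δ F L u₂) ∧ φ u₁ = u₂ ∧
    ∀ v ∈ transNodes δ F L u₁, ∀ w ∈ transNodes δ F L u₁, ∀ p o : List Q,
      (transEdge δ F L u₁ v p o w ↔ transEdge δ F L u₂ (φ v) p o (φ w))


section Runs

variable (δ : Q → A → Option (A × Q))

theorem stateAct_eq_map_runState (q : Q) (u : List A) :
    stateAct δ q u = (runState δ q u).map Prod.fst := by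
  induction u generalizing q with
  | nil => rfl
  | cons a u ih =>
    simp only [stateAct, runState]
    cases δ q a with
    | none => rfl
    | some bp =>
      simp only [Option.bind_some, ih]
      cases runState δ bp.2 u <;> rfl

theorem seqAct_cons (q : Q) (l : List Q) (u : List A) :
    seqAct δ (q :: l) u = (seqAct δ l u).bind (stateAct δ q) := rfl

theorem seqAct_append (s m : List Q) (u : List A) :
    seqAct δ (s ++ m) u = (seqAct δ m u).bind (seqAct δ s) := by
  induction s with
  | nil =>
    rw [List.nil_append]
    cases seqAct δ m u <;> rfl
  | cons q s ih =>
    rw [List.cons_append, seqAct_cons, ih]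
    cases seqAct δ m u <;> rfl

theorem seqAct_eq_map_runSeq (l : List Q) (u : List A) :
    seqAct δ l u = (runSeq δ l u).map Prod.fst := by
  induction l with
  | nil => rfl
  | cons q l ih =>
    rw [seqAct_cons, ih, runSeq]
    cases runSeq δ l u with
    | none => rfl
    | some vr =>
      simp only [Option.map_some, Option.bind_some, stateAct_eq_map_runState]
      cases runState δ q vr.1 <;> rfl

theorem runState_append (q : Q) (u x : List A) :
    runState δ q (u ++ x) = (runState δ q u).bind fun vp =>
      (runState δ vp.2 x).map fun yp => (vp.1 ++ yp.1, yp.2) := by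
  induction u generalizing q with
  | nil => cases h : runState δ q x <;> simp [runState, h]
  | cons a u ih =>
    simp only [List.cons_append, runState]
    cases δ q a with
    | none => rfl
    | some bp =>
      simp only [Option.bind_some, ih]
      cases runState δ bp.2 u with
      | none => rfl
      | some vp =>
        simp only [Option.map_some, Option.bind_some]
        cases runState δ vp.2 x <;> rfl

theorem runSeq_append (l : List Q) (u x : List A) :
    runSeq δ l (u ++ x) = (runSeq δ l u).bind fun vr =>
      (runSeq δ vr.2 x).map fun yr => (vr.1 ++ yr.1, yr.2) := by
  induction l with
  | nil => rfl
  | cons q l ih =>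
    simp only [runSeq, ih]
    cases runSeq δ l u with
    | none => rfl
    | some vr =>
      simp only [Option.bind_some]
      cases hq : runState δ q vr.1 with
      | none =>
        cases runSeq δ vr.2 x <;> simp [runState_append, hq]
      | some wp =>
        simp only [Option.map_some, Option.bind_some, runSeq]
        cases runSeq δ vr.2 x with
        | none => rfl
        | some yr =>
          simp only [Option.map_some, Option.bind_some, runState_append, hq]
          cases runState δ wp.2 yr.1 <;> rfl

variable {δ}

theorem length_of_stateAct_eq_some {q : Q} {u v : List A} (h : stateAct δ q u = some v) :
    v.length = u.length := by
  induction u generalizing q v with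
  | nil => simp_all [stateAct]
  | cons a u ih =>
    simp only [stateAct, Option.bind_eq_some_iff, Option.map_eq_some_iff] at h
    obtain ⟨bp, -, w, hw, rfl⟩ := h
    simp [ih hw]

theorem length_of_seqAct_eq_some {l : List Q} {u v : List A} (h : seqAct δ l u = some v) :
    v.length = u.length := by
  induction l generalizing v with
  | nil => simp_all [seqAct]
  | cons q l ih =>
    simp only [seqAct_cons, Option.bind_eq_some_iff] at h
    obtain ⟨w, hw, hv⟩ := h
    rw [length_of_stateAct_eq_some hv, ih hw]

theorem length_of_runSeq_eq_some {l : List Q} {u v : List A} {r : List Q}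
    (h : runSeq δ l u = some (v, r)) : v.length = u.length :=
  length_of_seqAct_eq_some (δ := δ) (l := l) (by simp [seqAct_eq_map_runSeq, h])

theorem seqAct_append_eq_some_iff {l : List Q} {u x z : List A} :
    seqAct δ l (u ++ x) = some z ↔
      ∃ v r y, runSeq δ l u = some (v, r) ∧ seqAct δ r x = some y ∧ z = v ++ y := by
  simp only [seqAct_eq_map_runSeq, runSeq_append]
  cases runSeq δ l u with
  | none => simp
  | some vr =>
    cases h : runSeq δ vr.2 x <;> aesop

theorem exists_prefix_of_seqAct_append {l : List Q} {u x z : List A}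
    (h : seqAct δ l (u ++ x) = some z) :
    ∃ v y, seqAct δ l u = some v ∧ z = v ++ y := by
  obtain ⟨v, r, y, hv, -, rfl⟩ := seqAct_append_eq_some_iff.1 h
  exact ⟨v, y, by simp [seqAct_eq_map_runSeq, hv], rfl⟩

end Runs

section OmegaWords

theorem length_pre (ξ : ℕ → A) (n : ℕ) : (pre ξ n).length = n := by simp [pre]

theorem pre_succ (ξ : ℕ → A) (n : ℕ) : pre ξ (n + 1) = pre ξ n ++ [ξ n] := by
  simp only [pre, List.ofFn_succ_last, Fin.val_castSucc, Fin.val_last]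

theorem pre_prefix (ξ : ℕ → A) {m n : ℕ} (h : m ≤ n) : pre ξ m <+: pre ξ n := by
  induction n, h using Nat.le_induction with
  | base => exact List.prefix_rfl
  | succ n _ ih => exact ih.trans (pre_succ ξ n ▸ List.prefix_append _ _)

theorem ext_of_pre {η η' : ℕ → A} (h : ∀ n, pre η n = pre η' n) : η = η' := by
  funext n
  have := h (n + 1)
  rw [pre_succ, pre_succ, h n] at this
  simpa using this

variable {δ : Q → A → Option (A × Q)}

theorem seqAct_pre_isSome_of_le {l : List Q} {ξ : ℕ → A} {m n : ℕ} (hmn : m ≤ n)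
    (h : (seqAct δ l (pre ξ n)).isSome) : (seqAct δ l (pre ξ m)).isSome := by
  obtain ⟨x, hx⟩ := pre_prefix ξ hmn
  obtain ⟨z, hz⟩ := Option.isSome_iff_exists.1 h
  rw [← hx] at hz
  obtain ⟨v, y, hv, -⟩ := exists_prefix_of_seqAct_append hz
  simp [hv]

/-- A state sequence defined on every prefix of an ω-word is defined on the ω-word. -/
theorem exists_omega_image {l : List Q} {ξ : ℕ → A}
    (h : ∀ n, (seqAct δ l (pre ξ n)).isSome) :
    ∃ η : ℕ → A, ∀ n, seqAct δ l (pre ξ n) = some (pre η n) := by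
  choose v hv using fun n => Option.isSome_iff_exists.1 (h n)
  have hlen (n : ℕ) : (v n).length = n := by
    rw [length_of_seqAct_eq_some (hv n), length_pre]
  have hstep (n : ℕ) : ∃ a, v (n + 1) = v n ++ [a] := by
    have h1 := hv (n + 1)
    rw [pre_succ] at h1
    obtain ⟨w, y, hw, hy⟩ := exists_prefix_of_seqAct_append h1
    obtain rfl : v n = w := by simpa [hv n] using hw
    have h2 := congrArg List.length hy
    simp only [List.length_append, hlen] at h2
    obtain ⟨a, rfl⟩ := List.length_eq_one_iff.1 (show y.length = 1 by omega)
    exact ⟨a, hy⟩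
  choose η hη using hstep
  refine ⟨η, fun n => ?_⟩
  rw [hv]
  congr 1
  induction n with
  | zero => simpa [pre] using hlen 0
  | succ n ih => rw [hη, ih, pre_succ]

theorem orbit_finite [Finite A] (δ : Q → A → Option (A × Q)) (L : Set (List Q)) (u : List A) :
    (orbit δ L u).Finite := by
  refine (List.finite_length_eq A u.length).subset ?_
  rintro v ⟨l, -, h⟩
  exact length_of_seqAct_eq_some h

theorem omegaOrbit_finite_of_mapsOf_finite {L : Set (List Q)} (h : (mapsOf δ L).Finite)
    (ξ : ℕ → A) : (omegaOrbit δ L ξ).Finite := by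
  refine (h.biUnion (t := fun f => {η : ℕ → A | ∀ n, f (pre ξ n) = some (pre η n)})
    fun f _ => Set.Subsingleton.finite ?_).subset ?_
  · intro η hη η' hη'
    exact ext_of_pre fun n => Option.some_injective _ ((hη n).symm.trans (hη' n))
  · rintro η ⟨l, hl, h⟩
    exact Set.mem_biUnion (⟨l, hl, rfl⟩ : seqAct δ l ∈ mapsOf δ L) h

end OmegaWords

section SuffixClosure

variable {δ : Q → A → Option (A × Q)}

/-- All suffixes, over the state alphabet, of elements of `L`. -/
def suffixes (L : Set (List Q)) : Set (List Q) := {m | ∃ l ∈ L, m <:+ l}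

theorem subset_suffixes (L : Set (List Q)) : L ⊆ suffixes L :=
  fun l hl => ⟨l, hl, List.suffix_rfl⟩

theorem tail_mem_suffixes {L : Set (List Q)} {q : Q} {l : List Q}
    (h : q :: l ∈ suffixes L) : l ∈ suffixes L := by
  obtain ⟨m, hm, hs⟩ := h
  exact ⟨m, hm, (List.suffix_cons q l).trans hs⟩

theorem exists_append_of_suffix_flatten {F L : Set (List Q)} {m : List Q}
    (fs : List (List Q)) (hF : ∀ f ∈ fs, f ∈ F) (hL : ∀ i, (fs.drop i).flatten ∈ L)
    (hm : m <:+ fs.flatten) :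
    ∃ s ∈ insert [] (suffixes F), ∃ l ∈ L, m = s ++ l := by
  induction fs with
  | nil => exact ⟨[], Set.mem_insert _ _, [], by simpa using hL 0, by simpa using hm⟩
  | cons f fs ih =>
    obtain ⟨p, hp⟩ := hm
    rw [List.flatten_cons, List.append_eq_append_iff] at hp
    have hL' (i : ℕ) : (fs.drop i).flatten ∈ L := by simpa using hL (i + 1)
    rcases hp with ⟨s, hs, rfl⟩ | ⟨p', -, hp'⟩
    · exact ⟨s, Or.inr ⟨f, hF f (by simp), p, hs.symm⟩, _, by simpa using hL' 0, rfl⟩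
    · exact ih (fun g hg => hF g (by simp [hg])) hL' ⟨p', hp'.symm⟩

theorem suffixes_finite {F : Set (List Q)} (hF : F.Finite) : (suffixes F).Finite := by
  refine (hF.biUnion (t := fun f => {s | s ∈ f.tails}) fun f _ => List.finite_toSet _).subset ?_
  rintro s ⟨f, hf, hs⟩
  exact Set.mem_biUnion hf ((List.mem_tails _ _).2 hs)

theorem omegaOrbit_suffixes_finite {L : Set (List Q)} (hL : FinitelySuffixClosed L)
    {ξ : ℕ → A} (h : (omegaOrbit δ L ξ).Finite) : (omegaOrbit δ (suffixes L) ξ).Finite := by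
  obtain ⟨F, hF, -, hc⟩ := hL
  refine (((suffixes_finite hF).insert []).biUnion
    (t := fun s => ⋃ η ∈ omegaOrbit δ L ξ,
      {ζ : ℕ → A | ∀ n, seqAct δ s (pre η n) = some (pre ζ n)})
    fun s _ => h.biUnion fun η _ => Set.Subsingleton.finite ?_).subset ?_
  · intro ζ hζ ζ' hζ'
    exact ext_of_pre fun n => Option.some_injective _ ((hζ n).symm.trans (hζ' n))
  · rintro ζ ⟨m, ⟨l, hl, hml⟩, hm⟩
    obtain ⟨fs, hfs, rfl, hdrop⟩ := hc l hl
    obtain ⟨s, hs, l', hl', rfl⟩ := exists_append_of_suffix_flatten fs hfs hdrop hml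
    simp only [seqAct_append] at hm
    obtain ⟨η, hη⟩ := exists_omega_image (δ := δ) (l := l') (ξ := ξ) fun n => by
      obtain ⟨v, hv, -⟩ := Option.bind_eq_some_iff.1 (hm n)
      simp [hv]
    refine Set.mem_biUnion hs (Set.mem_biUnion ⟨l', hl', hη⟩ fun n => ?_)
    simpa [hη] using hm n

end SuffixClosure

section OrbitTypes

variable {δ : Q → A → Option (A × Q)} {L : Set (List Q)}

/-- The run of a state sequence in an abstract transducer `t` started at node `i`. -/
def typeRun {C : ℕ} (i : Fin C) (t : Fin C → Q → Option (Fin C × Q)) :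
    List Q → Option (Fin C × List Q)
  | [] => some (i, [])
  | q :: l => (typeRun i t l).bind fun jr => (t jr.1 q).map fun kp => (kp.1, kp.2 :: jr.2)

/-- `k` describes the orbital transducer of `w`, up to an injective renaming of its nodes. -/
def IsOrbitType (δ : Q → A → Option (A × Q)) (L : Set (List Q)) (w : List A) {C : ℕ}
    (k : List Q → Option (Fin C × List Q)) : Prop :=
  ∃ idx : List A → Fin C, Set.InjOn idx (orbit δ L w) ∧
    ∀ l ∈ L, k l = (runSeq δ l w).map (Prod.map idx id)

theorem mem_orbit_of_runSeq {l : List Q} (hl : l ∈ L) {w v : List A} {r : List Q}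
    (h : runSeq δ l w = some (v, r)) : v ∈ orbit δ L w :=
  ⟨l, hl, by simp [seqAct_eq_map_runSeq, h]⟩

/-- Orbits of bounded size have finitely many orbital transducers up to isomorphism. -/
theorem exists_finite_orbitTypes [Finite Q] [Finite A] (δ : Q → A → Option (A × Q))
    (hL : ∀ q l, q :: l ∈ L → l ∈ L) (C : ℕ) :
    ∃ K : Set (List Q → Option (Fin (C + 1) × List Q)), K.Finite ∧
      ∀ w, (orbit δ L w).ncard ≤ C → ∃ k ∈ K, IsOrbitType δ L w k := by
  classical
  refine ⟨Set.range fun d : Fin (C + 1) × (Fin (C + 1) → Q → Option (Fin (C + 1) × Q)) =>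
    typeRun d.1 d.2, Set.finite_range _, fun w hw => ?_⟩
  obtain ⟨idx, -, hidx⟩ := (orbit_finite δ L w).exists_injOn_of_encard_le
    (t := (Set.univ : Set (Fin (C + 1)))) (by
      rw [← (orbit_finite δ L w).cast_ncard_eq, Set.encard_univ,
        ENat.card_eq_coe_fintype_card, Fintype.card_fin]
      exact_mod_cast hw.trans (Nat.le_succ C))
  let t : Fin (C + 1) → Q → Option (Fin (C + 1) × Q) := fun i q =>
    if h : ∃ v ∈ orbit δ L w, idx v = i then (runState δ q h.choose).map (Prod.map idx id)
    else none
  have ht {v : List A} (hv : v ∈ orbit δ L w) (q : Q) :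
      t (idx v) q = (runState δ q v).map (Prod.map idx id) := by
    have h : ∃ v' ∈ orbit δ L w, idx v' = idx v := ⟨v, hv, rfl⟩
    simp only [t, dif_pos h]
    rw [hidx h.choose_spec.1 hv h.choose_spec.2]
  refine ⟨_, ⟨(idx w, t), rfl⟩, idx, hidx, fun l hl => ?_⟩
  induction l with
  | nil => rfl
  | cons q l ih =>
    have hl' := hL q l hl
    simp only [typeRun, runSeq, ih hl']
    cases hr : runSeq δ l w with
    | none => rfl
    | some vr =>
      simp only [Option.map_some, Option.bind_some, Prod.map_fst,
        ht (mem_orbit_of_runSeq hl' hr)]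
      cases runState δ q vr.1 <;> rfl

theorem IsOrbitType.ncard_orbit_append {w : List A} {C : ℕ}
    {k : List Q → Option (Fin C × List Q)} (h : IsOrbitType δ L w k) (x : List A) :
    (orbit δ L (w ++ x)).ncard =
      {iy : Fin C × List A | ∃ l ∈ L, ∃ r, k l = some (iy.1, r) ∧
        seqAct δ r x = some iy.2}.ncard := by
  obtain ⟨idx, hinj, hk⟩ := h
  have key {z : List A} (hz : z ∈ orbit δ L (w ++ x)) : z.take w.length ∈ orbit δ L w := by
    obtain ⟨l, hl, hz⟩ := hz
    obtain ⟨v, y, hv, rfl⟩ := exists_prefix_of_seqAct_append hz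
    rw [List.take_left' (length_of_seqAct_eq_some hv)]
    exact ⟨l, hl, hv⟩
  rw [← Set.InjOn.ncard_image
    (f := fun z : List A => (idx (z.take w.length), z.drop w.length))]
  · congr 1
    ext ⟨i, y⟩
    constructor
    · rintro ⟨z, ⟨l, hl, hz⟩, hzi⟩
      obtain ⟨v, r, y', hv, hr, rfl⟩ := seqAct_append_eq_some_iff.1 hz
      have hlen := length_of_runSeq_eq_some hv
      simp only [List.take_left' hlen, List.drop_left' hlen, Prod.mk.injEq] at hzi
      obtain ⟨rfl, rfl⟩ := hzi
      exact ⟨l, hl, r, by simp [hk l hl, hv], hr⟩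
    · rintro ⟨l, hl, r, hkl, hr⟩
      rw [hk l hl] at hkl
      obtain ⟨⟨v, r'⟩, hv, hvr⟩ := Option.map_eq_some_iff.1 hkl
      simp only [Prod.map_apply, id_eq, Prod.mk.injEq] at hvr
      obtain ⟨rfl, rfl⟩ := hvr
      have hlen := length_of_runSeq_eq_some hv
      exact ⟨v ++ y, ⟨l, hl, seqAct_append_eq_some_iff.2 ⟨v, r', y, hv, hr, rfl⟩⟩,
        by simp only [List.take_left' hlen, List.drop_left' hlen]⟩
  · intro z hz z' hz' hzz
    simp only [Prod.mk.injEq] at hzz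
    rw [← List.take_append_drop w.length z, ← List.take_append_drop w.length z',
      hinj (key hz) (key hz') hzz.1, hzz.2]

theorem mapsOf_finite_of_ncard_orbit_le [Finite Q] [Finite A]
    (hL : ∀ q l, q :: l ∈ L → l ∈ L) {C : ℕ} (hC : ∀ u, (orbit δ L u).ncard ≤ C) :
    (mapsOf δ L).Finite := by
  obtain ⟨K, hK, hKt⟩ := exists_finite_orbitTypes δ hL C
  have := hK.to_subtype
  refine (Set.finite_iUnion (ι := K → Option (Fin (C + 1)))
    (f := fun s => seqAct δ '' {l | l ∈ L ∧ s = fun k => (k.1 l).map Prod.fst})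
    fun s => Set.Subsingleton.finite ?_).subset ?_
  · rintro _ ⟨l, ⟨hl, hs⟩, rfl⟩ _ ⟨l', ⟨hl', hs'⟩, rfl⟩
    funext u
    obtain ⟨k, hkK, idx, hinj, hk⟩ := hKt u (hC u)
    have h := congrFun (hs.symm.trans hs') ⟨k, hkK⟩
    simp only [hk l hl, hk l' hl'] at h
    rw [seqAct_eq_map_runSeq, seqAct_eq_map_runSeq]
    cases hr : runSeq δ l u with
    | none => cases hr' : runSeq δ l' u <;> simp_all
    | some vr =>
      cases hr' : runSeq δ l' u with
      | none => simp [hr, hr'] at h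
      | some vr' =>
        simp only [hr, hr', Option.map_some, Prod.map_fst, Option.some.injEq] at h ⊢
        exact hinj (mem_orbit_of_runSeq hl hr) (mem_orbit_of_runSeq hl' hr') h
  · rintro _ ⟨l, hl, rfl⟩
    exact Set.mem_iUnion.2 ⟨_, l, ⟨hl, rfl⟩, rfl⟩

end OrbitTypes

section InfinitePotential

variable {δ : Q → A → Option (A × Q)} {L : Set (List Q)}

theorem InfinitePotential.append_or_exists_split {u : List A} (hu : InfinitePotential δ L u)
    (x : List A) : InfinitePotential δ L (u ++ x) ∨
      ∃ x' a y, x = x' ++ a :: y ∧ InfinitePotential δ L (u ++ x') ∧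
        ¬ InfinitePotential δ L (u ++ x' ++ [a]) := by
  induction x using List.reverseRecOn with
  | nil => exact Or.inl (by simpa using hu)
  | append_singleton x b ih =>
    rcases ih with h | ⟨x', a, y, rfl, h1, h2⟩
    · by_cases hb : InfinitePotential δ L (u ++ (x ++ [b]))
      · exact Or.inl hb
      · exact Or.inr ⟨x, b, [], rfl, h, by simpa using hb⟩
    · exact Or.inr ⟨x', a, y ++ [b], by simp, h1, h2⟩

/-- A word of infinite potential can be extended to a word of infinite potential with an
arbitrarily large orbit. -/
theorem InfinitePotential.exists_append [Finite Q] [Finite A]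
    (hL : ∀ q l, q :: l ∈ L → l ∈ L) {u : List A} (hu : InfinitePotential δ L u) (C : ℕ) :
    ∃ x, InfinitePotential δ L (u ++ x) ∧ C < (orbit δ L (u ++ x)).ncard := by
  by_contra! hC
  obtain ⟨K, hK, hKt⟩ := exists_finite_orbitTypes δ hL C
  have hM (k : List Q → Option (Fin (C + 1) × List Q)) (a : A) : ∃ M : ℕ, ∀ w,
      IsOrbitType δ L w k → ¬ InfinitePotential δ L (w ++ [a]) →
        ∀ y, (orbit δ L (w ++ a :: y)).ncard ≤ M := by
    by_cases h : ∃ w, IsOrbitType δ L w k ∧ ¬ InfinitePotential δ L (w ++ [a])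
    · obtain ⟨w, hw, hwa⟩ := h
      simp only [InfinitePotential, not_forall, not_exists, not_lt] at hwa
      obtain ⟨M, hM⟩ := hwa
      refine ⟨M, fun w' hw' _ y => ?_⟩
      rw [hw'.ncard_orbit_append, ← hw.ncard_orbit_append]
      simpa using hM y
    · exact ⟨0, fun w hw hwa => absurd ⟨w, hw, hwa⟩ h⟩
  choose M hM using hM
  obtain ⟨B, hB⟩ := ((hK.prod (Set.finite_univ (α := A))).image fun ka => M ka.1 ka.2).bddAbove
  obtain ⟨x, hx⟩ := hu (max C B)
  rw [max_lt_iff] at hx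
  rcases hu.append_or_exists_split x with h | ⟨x', a, y, rfl, h1, h2⟩
  · exact absurd hx.1 (hC x h).not_gt
  · obtain ⟨k, hkK, hk⟩ := hKt _ (hC x' h1)
    have h3 := hM k a _ hk h2 y
    have h4 : M k a ≤ B := hB ⟨(k, a), ⟨hkK, Set.mem_univ a⟩, rfl⟩
    rw [← List.append_assoc] at hx
    omega

/-- An increasing chain of finite words of unbounded length has a common ω-extension. -/
theorem exists_pre_eq_of_chain (s : ℕ → List A) (hs : ∀ k, s k <+: s (k + 1))
    (hlen : ∀ k, k ≤ (s k).length) : ∃ ξ : ℕ → A, ∀ k, pre ξ (s k).length = s k := by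
  have hmono {i j : ℕ} (h : i ≤ j) : s i <+: s j := by
    induction j, h using Nat.le_induction with
    | base => exact List.prefix_rfl
    | succ n _ ih => exact ih.trans (hs n)
  refine ⟨fun n => (s (n + 1))[n]'(hlen (n + 1)), fun k => ?_⟩
  refine List.ext_getElem (length_pre _ _) fun n h1 h2 => ?_
  simp only [pre, List.getElem_ofFn]
  rcases le_total (n + 1) k with h | h
  · exact (hmono h).getElem _
  · exact ((hmono h).getElem h2).symm

theorem InfinitePotential.exists_omega [Finite Q] [Finite A]
    (hL : ∀ q l, q :: l ∈ L → l ∈ L) (h : InfinitePotential δ L []) :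
    ∃ ξ : ℕ → A, ∀ C, ∃ n ≥ C, C < (orbit δ L (pre ξ n)).ncard := by
  choose next hnext using fun (u : {u // InfinitePotential δ L u}) (C : ℕ) =>
    u.2.exists_append hL C
  let s : ℕ → {u // InfinitePotential δ L u} := fun k => Nat.rec ⟨[], h⟩
    (fun k u => ⟨_, (hnext u (max k (orbit δ L u.1).ncard)).1⟩) k
  have hs (k : ℕ) : (s (k + 1)).1 = (s k).1 ++ next (s k) (max k (orbit δ L (s k).1).ncard) := rfl
  have hcard (k : ℕ) : max k (orbit δ L (s k).1).ncard < (orbit δ L (s (k + 1)).1).ncard :=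
    hs k ▸ (hnext (s k) (max k (orbit δ L (s k).1).ncard)).2
  have hpre (k : ℕ) : (s k).1 <+: (s (k + 1)).1 := hs k ▸ List.prefix_append _ _
  have hlen (k : ℕ) : k ≤ (s k).1.length := by
    induction k with
    | zero => exact Nat.zero_le _
    | succ k ih =>
      refine ih.trans_lt ((hpre k).length_le.lt_of_ne fun he => ?_)
      have h1 := hcard k
      rw [← (hpre k).eq_of_length he] at h1
      exact (lt_of_le_of_lt (le_max_right _ _) h1).false
  obtain ⟨ξ, hξ⟩ := exists_pre_eq_of_chain (fun k => (s k).1) hpre hlen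
  refine ⟨ξ, fun C => ⟨(s (C + 1)).1.length, (Nat.le_succ C).trans (hlen _), ?_⟩⟩
  rw [hξ (C + 1)]
  exact (le_max_left _ _).trans_lt (hcard C)

theorem infinitePotential_nil_of_mapsOf_infinite [Finite Q] [Finite A]
    (hL : ∀ q l, q :: l ∈ L → l ∈ L) (h : (mapsOf δ L).Infinite) :
    InfinitePotential δ L [] := by
  intro C
  by_contra! hC
  exact h (mapsOf_finite_of_ncard_orbit_le hL (C := C) fun u => by simpa using hC u)

/-- If the orbit of an ω-word is finite, then the orbits of its long prefixes come from it. -/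
theorem exists_forall_orbit_pre_subset [Finite Q] (hL : ∀ q l, q :: l ∈ L → l ∈ L)
    {ξ : ℕ → A} (h : (omegaOrbit δ L ξ).Finite) :
    ∃ N, ∀ n ≥ N, orbit δ L (pre ξ n) ⊆ (fun η => pre η n) '' omegaOrbit δ L ξ := by
  have hN (η : ℕ → A) (q : Q) : ∃ N, ∀ n ≥ N, (seqAct δ [q] (pre η n)).isSome →
      ∀ m, (seqAct δ [q] (pre η m)).isSome := by
    by_cases hd : ∀ m, (seqAct δ [q] (pre η m)).isSome
    · exact ⟨0, fun _ _ _ => hd⟩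
    · obtain ⟨N, hN⟩ := not_forall.1 hd
      exact ⟨N, fun n hn hs => absurd (seqAct_pre_isSome_of_le hn hs) hN⟩
  choose N hN using hN
  obtain ⟨B, hB⟩ := ((h.prod (Set.finite_univ (α := Q))).image fun p => N p.1 p.2).bddAbove
  have key (l : List Q) (hl : l ∈ L) (n : ℕ) (hn : B ≤ n)
      (hs : (seqAct δ l (pre ξ n)).isSome) :
      ∃ η : ℕ → A, ∀ m, seqAct δ l (pre ξ m) = some (pre η m) := by
    induction l with
    | nil => exact ⟨ξ, fun _ => rfl⟩
    | cons q l ih =>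
      have hl' := hL q l hl
      obtain ⟨v, hv⟩ := Option.isSome_iff_exists.1 hs
      rw [seqAct_cons] at hv
      obtain ⟨w, hw, -⟩ := Option.bind_eq_some_iff.1 hv
      obtain ⟨η, hη⟩ := ih hl' (by simp [hw])
      have hact (m : ℕ) : seqAct δ (q :: l) (pre ξ m) = seqAct δ [q] (pre η m) := by
        rw [seqAct_cons, hη]
        rfl
      have hNB : N η q ≤ B := hB ⟨(η, q), ⟨⟨l, hl', hη⟩, Set.mem_univ q⟩, rfl⟩
      refine exists_omega_image fun m => ?_
      rw [hact]
      exact hN η q n (hNB.trans hn) (hact n ▸ hs) m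
  refine ⟨B, ?_⟩
  rintro n hn v ⟨l, hl, hv⟩
  obtain ⟨η, hη⟩ := key l hl n hn (by simp [hv])
  exact ⟨η, ⟨l, hl, hη⟩, Option.some_injective _ ((hη n).symm.trans hv)⟩

theorem omegaOrbit_infinite_of_unbounded [Finite Q] (hL : ∀ q l, q :: l ∈ L → l ∈ L)
    {ξ : ℕ → A} (hξ : ∀ C, ∃ n ≥ C, C < (orbit δ L (pre ξ n)).ncard) :
    (omegaOrbit δ L ξ).Infinite := by
  intro hfin
  obtain ⟨N, hN⟩ := exists_forall_orbit_pre_subset hL hfin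
  obtain ⟨n, hn, hlt⟩ := hξ (max N (omegaOrbit δ L ξ).ncard)
  have h1 := Set.ncard_le_ncard (hN n ((le_max_left _ _).trans hn)) (hfin.image _)
  have h2 := Set.ncard_image_le (f := fun η => pre η n) hfin
  omega

end InfinitePotential

/-- For a finitely suffix-closed `L ⊆ Q*`, the subset `L∘` of `S(T)` is
infinite iff there is an ω-word `ξ` with infinite `L`-orbit `L∘ξ`. -/
theorem mapsOf_infinite_iff_omegaOrbit_infinite {Q A : Type*} [Fintype Q] [Fintype A]
    [Nonempty A] (δ : Q → A → Option (A × Q)) (L : Set (List Q))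
    (hL : FinitelySuffixClosed L) :
    (mapsOf δ L).Infinite ↔ ∃ ξ : ℕ → A, (omegaOrbit δ L ξ).Infinite := by
  constructor
  · intro h
    have hs : ∀ q l, q :: l ∈ suffixes L → l ∈ suffixes L := fun _ _ => tail_mem_suffixes
    have hinf : (mapsOf δ (suffixes L)).Infinite :=
      h.mono fun _ hf => hf.imp fun _ hl => hl.imp_left (subset_suffixes L ·)
    obtain ⟨ξ, hξ⟩ := (infinitePotential_nil_of_mapsOf_infinite hs hinf).exists_omega hs
    exact ⟨ξ, fun hfin => omegaOrbit_infinite_of_unbounded hs hξ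
      (omegaOrbit_suffixes_finite hL hfin)⟩
  · rintro ⟨ξ, hξ⟩ hfin
    exact hξ (omegaOrbit_finite_of_mapsOf_finite hfin ξ)

end AutOrbit
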